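/- For every n ∈ ℕ, the closure of X_n in E(𝓕), with its subspace topology, is homeomorphic to complete Erdős space 𝔈_c. -/

import Mathlib

/- Complete Erdős space 𝔈_c, realized inside the real Hilbert space ℓ². -/

noncomputable section
open Topology Filter TopologicalSpace

/-- The set of points of ℓ² all of whose coordinates lie in {0} ∪ {1/(m+1) : m ∈ ℕ}. -/
def ErdosSet : Set (lp (fun _ : ℕ => ℝ) 2) :=
  {x | ∀ n : ℕ, x n = 0 ∨ ∃ m : ℕ, x n = 1 / (m + 1)}

/-- Complete Erdős space 𝔈_c, with the subspace (norm) topology from ℓ². -/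
abbrev Ec := ↥ErdosSet

/-- The σ-product σ𝔈_c ⊆ 𝔈_c^ω : sequences which are the zero point of 𝔈_c in all but
finitely many coordinates, with the subspace topology from the product 𝔈_c^ω. -/
def sigmaErdos : Set (ℕ → Ec) :=
  {y | {n : ℕ | (y n : lp (fun _ : ℕ => ℝ) 2) ≠ 0}.Finite}

/- The dynamical model: F(t) = 3^t − 1 acting on ℝ × ℤ^ω (ℤ discrete, product topology). -/

/-- `F t = 3 ^ t - 1` (real exponent). -/
def F : ℝ → ℝ := fun t => (3 : ℝ) ^ t - 1

/-- The inverse of `F` on `[0, ∞)`: `F⁻¹ t = log₃ (t + 1)`. -/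
def Finv : ℝ → ℝ := fun t => Real.logb 3 (t + 1)

/-- The shift map on integer sequences. -/
def shift : (ℕ → ℤ) → (ℕ → ℤ) := fun s n => s (n + 1)

/-- The map 𝓕(t, s) = (F(t) − |s₀|, σ(s)). -/
def calF : ℝ × (ℕ → ℤ) → ℝ × (ℕ → ℤ) :=
  fun x => (F x.1 - (|x.2 0| : ℝ), shift x.2)

/-- J(𝓕) = {x : T(𝓕ⁿ(x)) ≥ 0 for all n ≥ 0} (the case n = 0 forces T(x) ≥ 0). -/
def J : Set (ℝ × (ℕ → ℤ)) := {x | ∀ n : ℕ, 0 ≤ (calF^[n] x).1}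

/-- 𝕊 = {s ∈ ℤ^ω : (t, s) ∈ J(𝓕) for some t ≥ 0}. -/
def Sset : Set (ℕ → ℤ) := {s | ∃ t : ℝ, 0 ≤ t ∧ (t, s) ∈ J}

/-- t_s = min {t ≥ 0 : (t, s) ∈ J(𝓕)} (as an infimum; for s ∈ 𝕊 it is attained). -/
def tmin (s : ℕ → ℤ) : ℝ := sInf {t : ℝ | (t, s) ∈ J}

/-- The endpoint set E(𝓕) = {(t_s, s) : s ∈ 𝕊}, a subspace of ℝ × ℤ^ω. -/
def Efan : Set (ℝ × (ℕ → ℤ)) := {x | x.2 ∈ Sset ∧ x.1 = tmin x.2}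

/-- t*_s = sup_{k ≥ 1} F^{−k}(|s_k|). -/
def tstar (s : ℕ → ℤ) : ℝ := ⨆ k : ℕ, Finv^[k + 1] (|s (k + 1)| : ℝ)

/-- X_n = {x ∈ E(𝓕) : t*_{σ^{2k²}(s(x))} > F^{k−n}(1) for all k > n}. -/
def Xfan (n : ℕ) : Set ↥Efan :=
  {x | ∀ k : ℕ, n < k → F^[k - n] 1 < tstar (shift^[2 * k ^ 2] (x : ℝ × (ℕ → ℤ)).2)}

/-- A topological space `A`, viewed as the graph of the lower semicontinuous function on `ℕ^ω`
which equals `φ a` at `c a` and `∞` outside the range of `c`. -/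
structure LSCGraph {A : Type*} [TopologicalSpace A] (φ : A → ℝ) (c : A → ℕ → ℕ) : Prop where
  nonneg : ∀ a, 0 ≤ φ a
  inducing : IsInducing fun a => (φ a, c a)
  injective : Function.Injective c
  complete : ∀ (s : ℕ → ℕ) (r : ℝ),
    (∀ k, ∃ x, (∀ i < k, c x i = s i) ∧ φ x ≤ r) → ∃ a, c a = s ∧ φ a ≤ r

/-- Every nonempty clopen set is unbounded with respect to `φ`. -/
def ClopenUnbounded {A : Type*} [TopologicalSpace A] (φ : A → ℝ) : Prop :=
  ∀ U : Set A, IsClopen U → U.Nonempty → ∀ R, ∃ x ∈ U, R ≤ φ x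

/-- Open sets that are closed in the coarser topology induced by `c`. -/
def IsNode {A : Type*} [TopologicalSpace A] (c : A → ℕ → ℕ) (U : Set A) : Prop :=
  IsOpen U ∧ ∀ a, (∀ k, ∃ x ∈ U, ∀ i < k, c x i = c a i) → a ∈ U

/-- The infimum of `φ` on `U`. -/
def infOn {A : Type*} (φ : A → ℝ) (U : Set A) : ℝ := sInf (φ '' U)

section Abstract

variable {A B : Type*} [TopologicalSpace A] [TopologicalSpace B]
  {φ : A → ℝ} {c : A → ℕ → ℕ} {ψ : B → ℝ} {d : B → ℕ → ℕ}

namespace LSCGraph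

lemma continuous_fun (h : LSCGraph φ c) : Continuous φ :=
  continuous_fst.comp h.inducing.continuous

lemma continuous_code (h : LSCGraph φ c) : Continuous c :=
  continuous_snd.comp h.inducing.continuous

lemma isClopen_cylinder (h : LSCGraph φ c) (s : ℕ → ℕ) (k : ℕ) :
    IsClopen {x | ∀ i < k, c x i = s i} := by
  have : {x | ∀ i < k, c x i = s i} = ⋂ i ∈ Set.Iio k, (fun x => c x i) ⁻¹' {s i} := by
    ext x; simp
  rw [this]
  refine (Set.finite_Iio k).isClopen_biInter fun i _ => ?_
  exact (isClopen_discrete _).preimage ((continuous_apply i).comp h.continuous_code)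

lemma exists_cylinder_lt (h : LSCGraph φ c) {a : A} {r : ℝ} (hr : r < φ a) :
    ∃ k, ∀ x, (∀ i < k, c x i = c a i) → r < φ x := by
  by_contra! H
  obtain ⟨b, hb, hbr⟩ := h.complete (c a) r H
  rw [h.injective hb] at hbr
  linarith

lemma infOn_le (h : LSCGraph φ c) {U : Set A} {a : A} (ha : a ∈ U) : infOn φ U ≤ φ a :=
  csInf_le ⟨0, by rintro _ ⟨x, -, rfl⟩; exact h.nonneg x⟩ ⟨a, ha, rfl⟩

end LSCGraph

lemma le_infOn {A : Type*} {φ : A → ℝ} {U : Set A} (hU : U.Nonempty) {r : ℝ}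
    (hr : ∀ a ∈ U, r ≤ φ a) : r ≤ infOn φ U :=
  le_csInf (hU.image φ) (by rintro _ ⟨x, hx, rfl⟩; exact hr x hx)

lemma exists_lt_infOn_add {A : Type*} {φ : A → ℝ} {U : Set A} (hU : U.Nonempty)
    {ε : ℝ} (hε : 0 < ε) :
    ∃ a ∈ U, φ a < infOn φ U + ε := by
  obtain ⟨_, ⟨a, ha, rfl⟩, h⟩ := exists_lt_of_csInf_lt (hU.image φ)
    (show sInf (φ '' U) < infOn φ U + ε by unfold infOn; linarith)
  exact ⟨a, ha, h⟩

lemma LSCGraph.infOn_mono (h : LSCGraph φ c) {U V : Set A} (hU : U.Nonempty) (hUV : U ⊆ V) :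
    infOn φ V ≤ infOn φ U :=
  le_infOn hU fun _ ha => h.infOn_le (hUV ha)

lemma IsNode.isClopen (h : LSCGraph φ c) {U : Set A} (hU : IsNode c U) : IsClopen U := by
  refine ⟨isClosed_of_closure_subset fun a ha => hU.2 a fun k => ?_, hU.1⟩
  obtain ⟨x, hx, hxU⟩ := mem_closure_iff.1 ha _ (h.isClopen_cylinder (c a) k).isOpen
    (fun _ _ => rfl)
  exact ⟨x, hxU, hx⟩

lemma IsNode.inter_cylinder (h : LSCGraph φ c) {U : Set A} (hU : IsNode c U) (s : ℕ → ℕ) (k : ℕ) :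
    IsNode c (U ∩ {x | ∀ i < k, c x i = s i}) := by
  refine ⟨hU.1.inter (h.isClopen_cylinder s k).isOpen, fun a ha => ⟨hU.2 a fun j => ?_, ?_⟩⟩
  · obtain ⟨x, hx, hxa⟩ := ha j
    exact ⟨x, hx.1, hxa⟩
  · obtain ⟨x, hx, hxa⟩ := ha k
    exact fun i hi => (hxa i hi).symm.trans (hx.2 i hi)

lemma IsNode.inter_coord (h : LSCGraph φ c) {U : Set A} (hU : IsNode c U) (k l : ℕ) :
    IsNode c (U ∩ {x | c x k = l}) := by
  refine ⟨hU.1.inter ?_, fun a ha => ⟨hU.2 a fun j => ?_, ?_⟩⟩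
  · exact (isOpen_discrete {l}).preimage ((continuous_apply k).comp h.continuous_code)
  · obtain ⟨x, hx, hxa⟩ := ha j
    exact ⟨x, hx.1, hxa⟩
  · obtain ⟨x, hx, hxa⟩ := ha (k + 1)
    exact (hxa k (by omega)).symm.trans hx.2

lemma exists_value_near (h : LSCGraph φ c) (hu : ClopenUnbounded φ) {V : Set A} (hV : IsNode c V)
    {y : A} (hy : y ∈ V) (n : ℕ) {t ε : ℝ} (ht : φ y < t) (hε : 0 < ε) :
    ∃ z ∈ V, (∀ i < n, c z i = c y i) ∧ t < φ z ∧ φ z < t + ε := by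
  by_contra! H
  set W := V ∩ {x | ∀ i < n, c x i = c y i} with hW
  have hWc : IsClopen W := (hV.inter_cylinder h _ _).isClopen h
  have heq : W ∩ {x | φ x ≤ t} = W ∩ {x | φ x < t + ε} := by
    ext x
    constructor
    · rintro ⟨h1, h2⟩
      exact ⟨h1, lt_of_le_of_lt (show φ x ≤ t from h2) (by linarith)⟩
    · rintro ⟨h1, h2⟩
      refine ⟨h1, ?_⟩
      by_contra h3
      exact absurd h2 (not_lt.2 (H x h1.1 h1.2 (not_le.1 h3)))
  have hclopen : IsClopen (W ∩ {x | φ x ≤ t}) := by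
    refine ⟨hWc.1.inter (isClosed_le h.continuous_fun continuous_const), ?_⟩
    rw [heq]
    exact hWc.2.inter (isOpen_lt h.continuous_fun continuous_const)
  obtain ⟨x, hx, hxR⟩ := hu _ hclopen ⟨y, ⟨hy, fun _ _ => rfl⟩, ht.le⟩ (t + 1)
  have : φ x ≤ t := hx.2
  linarith

/-- A node can be partitioned into nodes with approximately prescribed infima. -/
lemma exists_split (h : LSCGraph φ c) (hu : ClopenUnbounded φ) {V : Set A} (hV : IsNode c V)
    (hne : V.Nonempty) {ε : ℝ} (hε : 0 < ε) (I : Set ℕ) (u : ℕ → ℝ) (hu0 : ∀ i ∈ I, 0 ≤ u i)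
    {i₀ : ℕ} (hi₀ : i₀ ∈ I) (hi₀ε : u i₀ ≤ ε) :
    ∃ g : A → ℕ, ∀ i, IsNode c (V ∩ g ⁻¹' {i}) ∧ ((V ∩ g ⁻¹' {i}).Nonempty ↔ i ∈ I) ∧
      (i ∈ I → |infOn φ (V ∩ g ⁻¹' {i}) - infOn φ V - u i| ≤ 3 * ε) := by
  obtain ⟨y₀, hy₀, hy₀ε⟩ := exists_lt_infOn_add (φ := φ) hne hε
  let t : ℕ → ℝ := fun i => infOn φ V + max (u i) (2 * ε)
  have key : ∀ i n, ∃ y k, y ∈ V ∧ (∀ j < n, c y j = c y₀ j) ∧ ¬ (∀ j < k, c y j = c y₀ j) ∧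
      φ y < t i + ε ∧ ∀ z, (∀ j < k, c z j = c y j) → t i < φ z := by
    intro i n
    have h2 : φ y₀ < t i := by
      have := le_max_right (u i) (2 * ε)
      simp only [t]; linarith
    obtain ⟨y, hyV, hyn, hyt, hyt'⟩ := exists_value_near h hu hV hy₀ n h2 hε
    obtain ⟨k, hk⟩ := h.exists_cylinder_lt hyt
    obtain ⟨k', hk'⟩ := h.exists_cylinder_lt (h2.trans hyt)
    refine ⟨y, max k k', hyV, hyn, fun H => ?_, hyt', fun z hz => hk z fun j hj =>
      hz j (lt_of_lt_of_le hj (le_max_left _ _))⟩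
    exact lt_irrefl _ (hk' y₀ fun j hj => (H j (lt_of_lt_of_le hj (le_max_right _ _))).symm)
  choose Y K hYV hYn hYK hYt hYlt using key
  let n : ℕ → ℕ := fun i => Nat.rec 0 (fun i m => K i m) i
  have hn : ∀ i, n (i + 1) = K i (n i) := fun i => rfl
  have hmono : StrictMono n := by
    refine strictMono_nat_of_lt_succ fun i => ?_
    by_contra! H
    exact hYK i (n i) fun j hj => hYn i (n i) j (by rw [hn] at H; omega)
  have hle : ∀ i, i ≤ n i := fun i => hmono.id_le i
  let W : ℕ → Set A := fun i => V ∩ {z | ∀ j < n (i + 1), c z j = c (Y i (n i)) j}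
  have hW1 : ∀ i, ∀ z ∈ W i, ∀ j < n i, c z j = c y₀ j := fun i z hz j hj =>
    (hz.2 j (hj.trans (hmono (Nat.lt_succ_self i)))).trans (hYn i (n i) j hj)
  have hW2 : ∀ i, ∀ z ∈ W i, ¬ ∀ j < n (i + 1), c z j = c y₀ j := fun i z hz H =>
    hYK i (n i) fun j hj => (hz.2 j hj).symm.trans (H j hj)
  have hW3 : ∀ i, ∀ z ∈ W i, t i < φ z := fun i z hz => hYlt i (n i) z hz.2
  have hYW : ∀ i, Y i (n i) ∈ W i := fun i => ⟨hYV _ _, fun _ _ => rfl⟩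
  have hdisj : ∀ i i' z, z ∈ W i → z ∈ W i' → i ≤ i' := by
    intro i i' z hz hz'
    by_contra! H
    exact hW2 i' z hz' fun j hj => hW1 i z hz j (hj.trans_le (hmono.monotone H))
  classical
  let g : A → ℕ := fun z => if H : ∃ i ∈ I, i ≠ i₀ ∧ z ∈ W i then H.choose else i₀
  have hg1 : ∀ i ∈ I, i ≠ i₀ → ∀ z ∈ W i, g z = i := by
    intro i hi hi' z hz
    have H : ∃ i ∈ I, i ≠ i₀ ∧ z ∈ W i := ⟨i, hi, hi', hz⟩
    have : g z = H.choose := dif_pos H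
    rw [this]
    exact le_antisymm (hdisj _ _ z H.choose_spec.2.2 hz) (hdisj _ _ z hz H.choose_spec.2.2)
  have hg2 : ∀ z, g z = i₀ ∨ (g z ∈ I ∧ z ∈ W (g z)) := by
    intro z
    by_cases H : ∃ i ∈ I, i ≠ i₀ ∧ z ∈ W i
    · right
      have : g z = H.choose := dif_pos H
      rw [this]
      exact ⟨H.choose_spec.1, H.choose_spec.2.2⟩
    · left; exact dif_neg H
  have hg3 : ∀ z, g z = i₀ ↔ ∀ i ∈ I, i ≠ i₀ → z ∉ W i := by
    intro z
    constructor
    · intro hz i hi hi' hzi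
      exact hi' ((hg1 i hi hi' z hzi).symm.trans hz)
    · intro hz
      refine dif_neg ?_
      rintro ⟨i, hi, hi', hzi⟩
      exact hz i hi hi' hzi
  have hpiece : ∀ i ∈ I, i ≠ i₀ → V ∩ g ⁻¹' {i} = W i := by
    intro i hi hi'
    ext z
    constructor
    · rintro ⟨-, hz⟩
      rcases hg2 z with h1 | h1
      · exact absurd (hz.symm.trans h1) hi'
      · have hz' : g z = i := hz
        rw [hz'] at h1; exact h1.2
    · exact fun hz => ⟨hz.1, hg1 i hi hi' z hz⟩
  have hy₀g : g y₀ = i₀ := (hg3 y₀).2 fun i _ _ hz => hW2 i y₀ hz fun _ _ => rfl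
  have hempty : ∀ i ∉ I, V ∩ g ⁻¹' {i} = ∅ := by
    intro i hi
    refine Set.eq_empty_of_forall_notMem ?_
    rintro z ⟨-, hz⟩
    have hz' : g z = i := hz
    rcases hg2 z with h1 | h1
    · exact hi (by rw [← hz', h1]; exact hi₀)
    · exact hi (hz' ▸ h1.1)
  have hrest : IsNode c (V ∩ g ⁻¹' {i₀}) := by
    constructor
    · rw [isOpen_iff_mem_nhds]
      rintro a ⟨haV, hag⟩
      have hag' := (hg3 a).1 hag
      by_cases hay : c a = c y₀
      · have hay' := h.injective hay
        have : V ∩ {z | φ z < infOn φ V + 2 * ε} ∈ 𝓝 a := by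
          refine (hV.1.inter (isOpen_lt h.continuous_fun continuous_const)).mem_nhds ⟨haV, ?_⟩
          change φ a < _
          rw [hay']; linarith
        refine Filter.mem_of_superset this ?_
        rintro z ⟨hzV, hz⟩
        refine ⟨hzV, (hg3 z).2 fun i _ _ hzi => ?_⟩
        have h1 := hW3 i z hzi
        have h2 := le_max_right (u i) (2 * ε)
        have hz' : φ z < infOn φ V + 2 * ε := hz
        simp only [t] at h1; linarith
      · obtain ⟨j, hj⟩ := Function.ne_iff.1 hay
        have : V ∩ {z | ∀ i < n (j + 1), c z i = c a i} ∈ 𝓝 a :=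
          (hV.inter_cylinder h (c a) (n (j + 1))).1.mem_nhds ⟨haV, fun _ _ => rfl⟩
        refine Filter.mem_of_superset this ?_
        rintro z ⟨hzV, hz⟩
        refine ⟨hzV, (hg3 z).2 fun i hi hi' hzi => ?_⟩
        by_cases hij : i ≤ j
        · refine hag' i hi hi' ⟨haV, fun l hl => ?_⟩
          have := hmono.monotone (Nat.succ_le_succ hij)
          exact (hz l (lt_of_lt_of_le hl this)).symm.trans (hzi.2 l hl)
        · have h1 := hle (j + 1)
          have h2 : n (j + 1) ≤ n i := hmono.monotone (show j + 1 ≤ i by omega)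
          exact hj ((hz j (by omega)).symm.trans (hW1 i z hzi j (by omega)))
    · intro a ha
      have haV : a ∈ V := hV.2 a fun k => (ha k).imp fun x hx => ⟨hx.1.1, hx.2⟩
      refine ⟨haV, (hg3 a).2 fun i hi hi' hai => ?_⟩
      obtain ⟨x, hx, hxa⟩ := ha (n (i + 1))
      exact (hg3 x).1 hx.2 i hi hi' ⟨hx.1, fun j hj => (hxa j hj).trans (hai.2 j hj)⟩
  refine ⟨g, fun i => ?_⟩
  by_cases hi : i ∈ I
  · by_cases hii : i = i₀
    · subst hii
      refine ⟨hrest, ⟨fun _ => hi, fun _ => ⟨y₀, hy₀, hy₀g⟩⟩, fun _ => ?_⟩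
      have h1 := h.infOn_le (U := V ∩ g ⁻¹' {i}) ⟨hy₀, hy₀g⟩
      have h2 := h.infOn_mono (U := V ∩ g ⁻¹' {i}) ⟨y₀, hy₀, hy₀g⟩ Set.inter_subset_left
      have h3 := hu0 i hi
      rw [abs_le]; constructor <;> linarith
    · rw [hpiece i hi hii]
      refine ⟨hV.inter_cylinder h _ _, ⟨fun _ => hi, fun _ => ⟨_, hYW i⟩⟩, fun _ => ?_⟩
      have h1 := h.infOn_le (hYW i)
      have h2 := hYt i (n i)
      have h3 : t i ≤ infOn φ (W i) := le_infOn ⟨_, hYW i⟩ fun a ha => (hW3 i a ha).le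
      have h4 := hu0 i hi
      have h5 : max (u i) (2 * ε) ≤ u i + 2 * ε := max_le (by linarith) (by linarith)
      have h6 := le_max_left (u i) (2 * ε)
      simp only [t] at h2 h3
      rw [abs_le]; constructor <;> linarith
  · rw [hempty i hi]
    refine ⟨⟨isOpen_empty, fun a ha => ?_⟩, by simp [hi], fun H => absurd H hi⟩
    obtain ⟨x, hx, -⟩ := ha 0
    exact hx

/-- Labelled partitions of `A` and `B` into nodes, using the same labels. -/
structure Matching (c : A → ℕ → ℕ) (d : B → ℕ → ℕ) (p : A → ℕ) (q : B → ℕ) : Prop where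
  left : ∀ l, IsNode c (p ⁻¹' {l})
  right : ∀ l, IsNode d (q ⁻¹' {l})
  nonempty_iff : ∀ l, (p ⁻¹' {l}).Nonempty ↔ (q ⁻¹' {l}).Nonempty

lemma Matching.symm {p : A → ℕ} {q : B → ℕ} (M : Matching c d p q) : Matching d c q p :=
  ⟨M.right, M.left, fun l => (M.nonempty_iff l).symm⟩

lemma preimage_pair {X : Type*} (f g : X → ℕ) (l : ℕ) :
    (fun x => Nat.pair (f x) (g x)) ⁻¹' {l} = f ⁻¹' {l.unpair.1} ∩ g ⁻¹' {l.unpair.2} := by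
  ext x
  simp only [Set.mem_preimage, Set.mem_singleton_iff, Set.mem_inter_iff]
  constructor
  · rintro rfl; simp
  · rintro ⟨h1, h2⟩; rw [h1, h2, Nat.pair_unpair]

lemma Matching.refine {p : A → ℕ} {q : B → ℕ} (M : Matching c d p q) (hA : LSCGraph φ c)
    (hB : LSCGraph ψ d) (hu : ClopenUnbounded ψ) (k : ℕ) {ε : ℝ} (hε : 0 < ε) :
    ∃ g : B → ℕ, Matching c d (fun a => Nat.pair (p a) (c a k)) (fun b => Nat.pair (q b) (g b)) ∧
      ∀ a, |(infOn ψ ((fun b => Nat.pair (q b) (g b)) ⁻¹' {Nat.pair (p a) (c a k)}) -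
          infOn φ ((fun a => Nat.pair (p a) (c a k)) ⁻¹' {Nat.pair (p a) (c a k)})) -
        (infOn ψ (q ⁻¹' {p a}) - infOn φ (p ⁻¹' {p a}))| ≤ ε := by
  have key : ∀ l, ∃ g : B → ℕ, (p ⁻¹' {l}).Nonempty → ∀ i,
      IsNode d (q ⁻¹' {l} ∩ g ⁻¹' {i}) ∧
      ((q ⁻¹' {l} ∩ g ⁻¹' {i}).Nonempty ↔ (p ⁻¹' {l} ∩ {x | c x k = i}).Nonempty) ∧
      ((p ⁻¹' {l} ∩ {x | c x k = i}).Nonempty →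
        |infOn ψ (q ⁻¹' {l} ∩ g ⁻¹' {i}) - infOn ψ (q ⁻¹' {l}) -
          (infOn φ (p ⁻¹' {l} ∩ {x | c x k = i}) - infOn φ (p ⁻¹' {l}))| ≤ 3 * (ε / 3)) := by
    intro l
    by_cases hl : (p ⁻¹' {l}).Nonempty
    · obtain ⟨a, ha, haε⟩ := exists_lt_infOn_add (φ := φ) hl (ε := ε / 3) (by linarith)
      obtain ⟨g, hg⟩ := exists_split hB hu (M.right l) ((M.nonempty_iff l).1 hl)
        (ε := ε / 3) (by linarith) {i | (p ⁻¹' {l} ∩ {x | c x k = i}).Nonempty}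
        (fun i => infOn φ (p ⁻¹' {l} ∩ {x | c x k = i}) - infOn φ (p ⁻¹' {l}))
        (fun i hi => sub_nonneg.2 (hA.infOn_mono hi Set.inter_subset_left))
        (i₀ := c a k) ⟨a, ha, rfl⟩
        (by
          have := hA.infOn_le (U := p ⁻¹' {l} ∩ {x | c x k = c a k}) ⟨ha, rfl⟩
          linarith)
      exact ⟨g, fun _ => hg⟩
    · exact ⟨fun _ => 0, fun H => absurd H hl⟩
  choose G hG using key
  have hGeq : ∀ l i, q ⁻¹' {l} ∩ (fun b => G (q b) b) ⁻¹' {i} = q ⁻¹' {l} ∩ G l ⁻¹' {i} := by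
    intro l i
    ext b
    simp only [Set.mem_inter_iff, Set.mem_preimage, Set.mem_singleton_iff]
    constructor
    · rintro ⟨rfl, h⟩; exact ⟨rfl, h⟩
    · rintro ⟨rfl, h⟩; exact ⟨rfl, h⟩
  have hceq : ∀ i, (fun a => c a k) ⁻¹' {i} = {x | c x k = i} := fun i => rfl
  refine ⟨fun b => G (q b) b, ⟨fun l => ?_, fun l => ?_, fun l => ?_⟩, fun a => ?_⟩
  · rw [preimage_pair, hceq]
    exact (M.left _).inter_coord hA _ _
  · rw [preimage_pair, hGeq]
    by_cases hl : (p ⁻¹' {l.unpair.1}).Nonempty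
    · exact (hG _ hl _).1
    · rw [M.nonempty_iff, Set.not_nonempty_iff_eq_empty] at hl
      rw [hl, Set.empty_inter]
      exact hl ▸ M.right l.unpair.1
  · rw [preimage_pair, preimage_pair, hGeq, hceq]
    by_cases hl : (p ⁻¹' {l.unpair.1}).Nonempty
    · exact (hG _ hl _).2.1.symm
    · have hl' := hl
      rw [M.nonempty_iff, Set.not_nonempty_iff_eq_empty] at hl'
      rw [Set.not_nonempty_iff_eq_empty] at hl
      rw [hl, hl']; simp
  · have := (hG (p a) ⟨a, rfl⟩ (c a k)).2.2 ⟨a, rfl, rfl⟩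
    rw [preimage_pair, preimage_pair, hGeq, hceq]
    simp only [Nat.unpair_pair]
    rw [abs_le] at this ⊢
    constructor <;> linarith [this.1, this.2]

/-- The label map of the coarser partition, as a function of the labels after two refinements. -/
def coarsen (l : ℕ) : ℕ := l.unpair.1.unpair.1

lemma Matching.refine_both {p : A → ℕ} {q : B → ℕ} (M : Matching c d p q) (hA : LSCGraph φ c)
    (hB : LSCGraph ψ d) (huA : ClopenUnbounded φ) (huB : ClopenUnbounded ψ) (k : ℕ) {ε : ℝ}
    (hε : 0 < ε) :
    ∃ p' : A → ℕ, ∃ q' : B → ℕ, Matching c d p' q' ∧ (∀ a, coarsen (p' a) = p a) ∧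
      (∀ b, coarsen (q' b) = q b) ∧ (∀ a, (p' a).unpair.1.unpair.2 = c a k) ∧
      (∀ b, (q' b).unpair.2 = d b k) ∧
      ∀ a, |(infOn ψ (q' ⁻¹' {p' a}) - infOn φ (p' ⁻¹' {p' a})) -
        (infOn ψ (q ⁻¹' {p a}) - infOn φ (p ⁻¹' {p a}))| ≤ ε := by
  obtain ⟨g, M₁, h₁⟩ := M.refine hA hB huB k (half_pos hε)
  obtain ⟨f, M₂, h₂⟩ := M₁.symm.refine hB hA huA k (half_pos hε)
  refine ⟨_, _, M₂.symm, fun a => by simp [coarsen], fun b => by simp [coarsen],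
    fun a => by simp, fun b => by simp, fun a => ?_⟩
  obtain ⟨b, hb⟩ := (M₂.symm.nonempty_iff _).1 ⟨a, rfl⟩
  have e1 := h₁ a
  have e2 := h₂ b
  have hb' : Nat.pair (Nat.pair (q b) (g b)) (d b k) =
    Nat.pair (Nat.pair (p a) (c a k)) (f a) := hb
  have hb'' : Nat.pair (q b) (g b) = Nat.pair (p a) (c a k) := (Nat.pair_eq_pair.1 hb').1
  rw [hb', hb''] at e2
  rw [abs_le] at e1 e2 ⊢
  constructor <;> linarith [e1.1, e1.2, e2.1, e2.2]


/-- A sequence of successively finer matchings which separates points on both sides, and along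
which the difference of the infima of corresponding nodes converges quickly. -/
structure MatchingSeq (φ : A → ℝ) (c : A → ℕ → ℕ) (ψ : B → ℝ) (d : B → ℕ → ℕ)
    (p : ℕ → A → ℕ) (q : ℕ → B → ℕ) : Prop where
  matching : ∀ n, Matching c d (p n) (q n)
  coarsen_left : ∀ n a, coarsen (p (n + 1) a) = p n a
  coarsen_right : ∀ n b, coarsen (q (n + 1) b) = q n b
  code_left : ∀ n a a', p (n + 1) a = p (n + 1) a' → c a n = c a' n
  code_right : ∀ n b b', q (n + 1) b = q (n + 1) b' → d b n = d b' n
  gap : ∀ n a, |(infOn ψ (q (n + 1) ⁻¹' {p (n + 1) a}) - infOn φ (p (n + 1) ⁻¹' {p (n + 1) a})) -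
        (infOn ψ (q n ⁻¹' {p n a}) - infOn φ (p n ⁻¹' {p n a}))| ≤ 1 / 2 / 2 ^ n

lemma isNode_const (c : A → ℕ → ℕ) (m l : ℕ) : IsNode c ((fun _ => m) ⁻¹' {l}) := by
  by_cases hl : m = l
  · exact ⟨by simp [hl], fun a _ => hl⟩
  · exact ⟨by simp [hl], fun a ha => (ha 0).choose_spec.1⟩

lemma exists_matchingSeq (hA : LSCGraph φ c) (hB : LSCGraph ψ d) (huA : ClopenUnbounded φ)
    (huB : ClopenUnbounded ψ) [Nonempty A] [Nonempty B] :
    ∃ p q, MatchingSeq φ c ψ d p q := by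
  have M₀ : Matching c d (fun _ => 0) (fun _ => 0) :=
    ⟨isNode_const c 0, isNode_const d 0, fun l => by by_cases hl : 0 = l <;> simp [hl]⟩
  have key : ∀ (n : ℕ) (S : {S : (A → ℕ) × (B → ℕ) // Matching c d S.1 S.2}),
      ∃ S' : {S : (A → ℕ) × (B → ℕ) // Matching c d S.1 S.2},
      (∀ a, coarsen (S'.1.1 a) = S.1.1 a) ∧ (∀ b, coarsen (S'.1.2 b) = S.1.2 b) ∧
      (∀ a, (S'.1.1 a).unpair.1.unpair.2 = c a n) ∧ (∀ b, (S'.1.2 b).unpair.2 = d b n) ∧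
      ∀ a, |(infOn ψ (S'.1.2 ⁻¹' {S'.1.1 a}) - infOn φ (S'.1.1 ⁻¹' {S'.1.1 a})) -
        (infOn ψ (S.1.2 ⁻¹' {S.1.1 a}) - infOn φ (S.1.1 ⁻¹' {S.1.1 a}))| ≤ 1 / 2 / 2 ^ n := by
    rintro n ⟨⟨p, q⟩, M⟩
    obtain ⟨p', q', M', h⟩ := M.refine_both hA hB huA huB n (ε := 1 / 2 / 2 ^ n) (by positivity)
    exact ⟨⟨⟨p', q'⟩, M'⟩, h⟩
  choose G hG using key
  let S : ℕ → {S : (A → ℕ) × (B → ℕ) // Matching c d S.1 S.2} :=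
    fun n => Nat.rec ⟨⟨_, _⟩, M₀⟩ (fun n S => G n S) n
  have hS : ∀ n, S (n + 1) = G n (S n) := fun _ => rfl
  refine ⟨fun n => (S n).1.1, fun n => (S n).1.2, fun n => (S n).2, fun n => ?_, fun n => ?_,
    fun n a a' h => ?_, fun n a a' h => ?_, fun n => ?_⟩
  · exact (hG n (S n)).1
  · exact (hG n (S n)).2.1
  · have h' := (hG n (S n)).2.2.1
    rw [← h' a, ← h' a']
    exact congrArg (fun l => (Nat.unpair (Nat.unpair l).1).2) h
  · have h' := (hG n (S n)).2.2.2.1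
    rw [← h' a, ← h' a']
    exact congrArg (fun l => (Nat.unpair l).2) h
  · exact (hG n (S n)).2.2.2.2

namespace MatchingSeq

variable {p : ℕ → A → ℕ} {q : ℕ → B → ℕ}

lemma symm (S : MatchingSeq φ c ψ d p q) : MatchingSeq ψ d φ c q p := by
  refine ⟨fun n => (S.matching n).symm, S.coarsen_right, S.coarsen_left, S.code_right,
    S.code_left, fun n b => ?_⟩
  obtain ⟨a, ha⟩ := ((S.matching (n + 1)).nonempty_iff (q (n + 1) b)).2 ⟨b, rfl⟩
  have ha : p (n + 1) a = q (n + 1) b := ha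
  have ha' : p n a = q n b := by rw [← S.coarsen_left, ← S.coarsen_right, ha]
  have := S.gap n a
  rw [ha, ha', ← abs_neg] at this
  convert this using 2
  ring

lemma eq_of_le (S : MatchingSeq φ c ψ d p q) {m n : ℕ} (h : m ≤ n) {a a' : A}
    (ha : p n a = p n a') : p m a = p m a' := by
  induction n, h using Nat.le_induction with
  | base => exact ha
  | succ n _ ih => exact ih (by rw [← S.coarsen_left n a, ← S.coarsen_left n a', ha])

lemma eq_of_le_mixed (S : MatchingSeq φ c ψ d p q) {m n : ℕ} (h : m ≤ n) {a : A} {b : B}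
    (ha : p n a = q n b) : p m a = q m b := by
  induction n, h using Nat.le_induction with
  | base => exact ha
  | succ n _ ih => exact ih (by rw [← S.coarsen_left, ← S.coarsen_right, ha])

lemma code_eq (S : MatchingSeq φ c ψ d p q) {n i : ℕ} (hi : i < n) {a a' : A}
    (h : p n a = p n a') : c a i = c a' i :=
  S.code_left i a a' (S.eq_of_le (Nat.succ_le_of_lt hi) h)

lemma eq_of_forall (S : MatchingSeq φ c ψ d p q) (hA : LSCGraph φ c) {a a' : A}
    (h : ∀ n, p n a = p n a') : a = a' :=
  hA.injective (funext fun i => S.code_eq (Nat.lt_succ_self i) (h (i + 1)))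

lemma tendsto_infOn (S : MatchingSeq φ c ψ d p q) (hA : LSCGraph φ c) (a : A) :
    Tendsto (fun n => infOn φ (p n ⁻¹' {p n a})) atTop (𝓝 (φ a)) := by
  rw [tendsto_order]
  refine ⟨fun r hr => ?_, fun r hr => .of_forall fun n => 
    (hA.infOn_le (U := p n ⁻¹' {p n a}) rfl).trans_lt hr⟩
  obtain ⟨r', hrr', hr'⟩ := exists_between hr
  obtain ⟨k, hk⟩ := hA.exists_cylinder_lt hr'
  filter_upwards [eventually_ge_atTop k] with n hn
  refine hrr'.trans_le (le_infOn (U := p n ⁻¹' {p n a}) ⟨a, rfl⟩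
    fun x hx => (hk x fun i hi => ?_).le)
  exact S.code_eq (hi.trans_le hn) hx

lemma exists_partner (S : MatchingSeq φ c ψ d p q) (hA : LSCGraph φ c) (hB : LSCGraph ψ d)
    (a : A) : ∃ b, ∀ n, q n b = p n a := by
  have hne : ∀ n, (q n ⁻¹' {p n a}).Nonempty := fun n =>
    ((S.matching n).nonempty_iff _).1 ⟨a, rfl⟩
  have hcau := cauchySeq_of_le_geometric_two (C := 1)
    (f := fun n => infOn ψ (q n ⁻¹' {p n a}) - infOn φ (p n ⁻¹' {p n a}))
    (fun n => by rw [dist_comm, Real.dist_eq]; exact S.gap n a)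
  obtain ⟨L, hL⟩ := cauchySeq_tendsto_of_complete hcau
  obtain ⟨R, hR⟩ := hL.bddAbove_range
  choose y hy hyψ using fun n => exists_lt_infOn_add (φ := ψ) (hne n) one_pos
  have hbound : ∀ n, ψ (y n) ≤ φ a + R + 1 := by
    intro n
    have h1 := hyψ n
    have h2 := hR ⟨n, rfl⟩
    have h3 := hA.infOn_le (U := p n ⁻¹' {p n a}) (a := a) rfl
    simp only at h2
    linarith
  have hyq : ∀ m n, m ≤ n → q m (y n) = p m a := fun m n hmn =>
    (S.eq_of_le_mixed hmn (hy n).symm).symm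
  obtain ⟨b, hb, -⟩ := hB.complete (fun i => d (y (i + 1)) i) (φ a + R + 1) fun k =>
    ⟨y k, fun i hi => S.symm.code_eq (Nat.lt_succ_self i)
      ((hyq (i + 1) k hi).trans (hyq (i + 1) (i + 1) le_rfl).symm), hbound k⟩
  refine ⟨b, fun n => ((S.matching n).right (p n a)).2 b fun k => ?_⟩
  refine ⟨y (max n k), hyq n _ (le_max_left _ _), fun i hi => ?_⟩
  rw [hb]
  exact S.symm.code_eq (Nat.lt_succ_self i) ((hyq (i + 1) _ (hi.trans_le (le_max_right _ _))).trans
    (hyq (i + 1) (i + 1) le_rfl).symm)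

lemma continuous_label (S : MatchingSeq φ c ψ d p q) (n : ℕ) : Continuous (p n) := by
  refine continuous_discrete_rng.2 fun l => ((S.matching n).left l).1

lemma continuous_of_partner (S : MatchingSeq φ c ψ d p q) (hA : LSCGraph φ c) (hB : LSCGraph ψ d)
    {f : A → B} (hf : ∀ a n, q n (f a) = p n a) : Continuous f := by
  rw [hB.inducing.continuous_iff]
  refine Continuous.prodMk ?_ (continuous_pi fun i => ?_)
  · let e : ℕ → A → ℝ := fun n a => infOn ψ (q n ⁻¹' {p n a}) - infOn φ (p n ⁻¹' {p n a})
    have hlim : ∀ a, Tendsto (fun n => e n a) atTop (𝓝 (ψ (f a) - φ a)) := by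
      intro a
      have h1 := S.symm.tendsto_infOn hB (f a)
      simp only [hf] at h1
      exact h1.sub (S.tendsto_infOn hA a)
    have hdist : ∀ n a, dist (e n a) (ψ (f a) - φ a) ≤ 1 / 2 ^ n := fun n a =>
      dist_le_of_le_geometric_two_of_tendsto (f := fun n => e n a) (C := 1)
        (fun n => by rw [dist_comm, Real.dist_eq]; exact S.gap n a) (hlim a) n
    have hunif : TendstoUniformly e (fun a => ψ (f a) - φ a) atTop := by
      rw [Metric.tendstoUniformly_iff]
      intro ε hε
      have h2 : Tendsto (fun n : ℕ => (1 : ℝ) / 2 ^ n) atTop (𝓝 0) := by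
        simp_rw [one_div, ← inv_pow]
        exact tendsto_pow_atTop_nhds_zero_of_lt_one (by norm_num) (by norm_num)
      filter_upwards [h2.eventually_lt_const hε] with n hn a
      rw [dist_comm]
      exact (hdist n a).trans_lt hn
    have hcont : Continuous fun a => ψ (f a) - φ a := by
      refine hunif.continuous (Filter.Frequently.of_forall fun n => ?_)
      exact (continuous_of_discreteTopology (f := fun l =>
        infOn ψ (q n ⁻¹' {l}) - infOn φ (p n ⁻¹' {l}))).comp (S.continuous_label n)
    exact (hcont.add hA.continuous_fun).congr fun a => sub_add_cancel _ _
  · refine IsLocallyConstant.continuous ?_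
    rw [IsLocallyConstant.iff_eventually_eq]
    intro a
    have := (continuous_discrete_rng.1 (S.continuous_label (i + 1)) (p (i + 1) a)).mem_nhds
      (show a ∈ p (i + 1) ⁻¹' {p (i + 1) a} from rfl)
    filter_upwards [this] with x hx
    exact S.symm.code_eq (Nat.lt_succ_self i) (by rw [hf, hf]; exact hx)

end MatchingSeq

theorem LSCGraph.nonempty_homeomorph (hA : LSCGraph φ c) (hB : LSCGraph ψ d)
    (huA : ClopenUnbounded φ) (huB : ClopenUnbounded ψ) [Nonempty A] [Nonempty B] :
    Nonempty (A ≃ₜ B) := by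
  obtain ⟨p, q, S⟩ := exists_matchingSeq hA hB huA huB
  choose f hf using S.exists_partner hA hB
  choose g hg using S.symm.exists_partner hB hA
  exact ⟨{ toFun := f
           invFun := g
           left_inv := fun a => S.eq_of_forall hA fun n => by rw [hg, hf]
           right_inv := fun b => S.symm.eq_of_forall hB fun n => by rw [hf, hg]
           continuous_toFun := S.continuous_of_partner hA hB hf
           continuous_invFun := S.symm.continuous_of_partner hB hA hg }⟩

end Abstract


section Constructions

variable {A : Type*} [TopologicalSpace A] {φ : A → ℝ} {c : A → ℕ → ℕ}

lemma LSCGraph.tendsto (h : LSCGraph φ c) {x : ℕ → A} {a : A}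
    (hφ : Tendsto (fun n => φ (x n)) atTop (𝓝 (φ a)))
    (hc : ∀ i, ∀ᶠ n in atTop, c (x n) i = c a i) : Tendsto x atTop (𝓝 a) := by
  rw [h.inducing.tendsto_nhds_iff]
  refine hφ.prodMk_nhds (tendsto_pi_nhds.2 fun i => ?_)
  exact (tendsto_congr' (hc i)).2 tendsto_const_nhds

/-- If every point of a dense set starts a chain of points with small steps of `φ`, going to
infinity inside an arbitrary cylinder, then clopen sets are unbounded. -/
lemma LSCGraph.clopenUnbounded_of_chains (h : LSCGraph φ c) {D : Set A} (hD : Dense D)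
    (H : ∀ x ∈ D, ∀ k : ℕ, ∀ ε > 0, ∃ y : ℕ → A, y 0 = x ∧
      (∀ l, y l ∈ D ∧ (∀ i < k, c (y l) i = c x i) ∧ |φ (y (l + 1)) - φ (y l)| ≤ ε) ∧
      ∀ R, ∃ l, R ≤ φ (y l)) : ClopenUnbounded φ := by
  intro U hU hUne R
  by_contra! hR
  have step : ∀ (n k : ℕ) (x : A), ∃ (y y' : A) (k' : ℕ), x ∈ U ∩ D →
      y ∈ U ∩ D ∧ y' ∉ U ∧ (∀ i < k, c y i = c x i) ∧ (∀ i < k, c y' i = c x i) ∧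
      |φ y' - φ y| ≤ 1 / ((n : ℝ) + 1) ∧ k < k' ∧
      ∀ z, (∀ i < k', c z i = c y i) → φ y - 1 / ((n : ℝ) + 1) < φ z := by
    intro n k x
    by_cases hx : x ∈ U ∩ D
    · obtain ⟨y, hy0, hy, hyR⟩ := H x hx.2 k (1 / ((n : ℝ) + 1)) (by positivity)
      have hex : ∃ l, y l ∉ U := by
        obtain ⟨l, hl⟩ := hyR R
        exact ⟨l, fun hlU => absurd (hR _ hlU) (not_lt.2 hl)⟩
      classical
      have hpos : Nat.find hex ≠ 0 := fun h0 => by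
        have := Nat.find_spec hex
        rw [h0, hy0] at this
        exact this hx.1
      obtain ⟨l, hl⟩ := Nat.exists_eq_succ_of_ne_zero hpos
      have hlU : y l ∈ U := by
        by_contra hlU
        have := Nat.find_min' hex hlU
        omega
      have hlU' : y (l + 1) ∉ U := by
        have := Nat.find_spec hex
        rwa [hl] at this
      obtain ⟨k', hk'⟩ := h.exists_cylinder_lt
        (show φ (y l) - 1 / ((n : ℝ) + 1) < φ (y l) from sub_lt_self _ (by positivity))
      exact ⟨y l, y (l + 1), max k' (k + 1), fun _ => ⟨⟨hlU, (hy l).1⟩, hlU', (hy l).2.1,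
        (hy (l + 1)).2.1, (hy l).2.2, by omega,
        fun z hz => hk' z fun i hi => hz i (hi.trans_le (le_max_left _ _))⟩⟩
    · exact ⟨x, x, 0, fun hx' => absurd hx' hx⟩
  choose Y Y' K hYK using step
  obtain ⟨x₀, hx₀⟩ := hD.inter_open_nonempty U hU.2 hUne
  let st : ℕ → A × ℕ := fun n => Nat.rec (x₀, 0) (fun n s => (Y n s.2 s.1, K n s.2 s.1)) n
  let x : ℕ → A := fun n => (st n).1
  let k : ℕ → ℕ := fun n => (st n).2
  let x' : ℕ → A := fun n => Y' n (k n) (x n)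
  have hxU : ∀ n, x n ∈ U ∩ D := by
    intro n
    induction n with
    | zero => exact hx₀
    | succ n ih => exact (hYK n (k n) (x n) ih).1
  have hs := fun n => hYK n (k n) (x n) (hxU n)
  have hx'U : ∀ n, x' n ∉ U := fun n => (hs n).2.1
  have hx1 : ∀ n, ∀ i < k n, c (x (n + 1)) i = c (x n) i := fun n => (hs n).2.2.1
  have hx'1 : ∀ n, ∀ i < k n, c (x' n) i = c (x n) i := fun n => (hs n).2.2.2.1
  have hgap : ∀ n, |φ (x' n) - φ (x (n + 1))| ≤ 1 / ((n : ℝ) + 1) :=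
    fun n => (hs n).2.2.2.2.1
  have hkmono : StrictMono k := strictMono_nat_of_lt_succ fun n => (hs n).2.2.2.2.2.1
  have hlow : ∀ n z, (∀ i < k (n + 1), c z i = c (x (n + 1)) i) →
      φ (x (n + 1)) - 1 / ((n : ℝ) + 1) < φ z := fun n => (hs n).2.2.2.2.2.2
  have hkle : ∀ n, n ≤ k n := fun n => hkmono.id_le n
  have hagree : ∀ m n, m ≤ n → ∀ i < k m, c (x n) i = c (x m) i := by
    intro m n hmn
    induction n, hmn using Nat.le_induction with
    | base => exact fun _ _ => rfl
    | succ n hmn ih =>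
      exact fun i hi => (hx1 n i (hi.trans_le (hkmono.monotone hmn))).trans (ih i hi)
  obtain ⟨a, ha, -⟩ := h.complete (fun i => c (x (i + 1)) i) R fun j =>
    ⟨x j, fun i hi => hagree (i + 1) j hi i (hkle (i + 1)), (hR _ (hxU j).1).le⟩
  have hca : ∀ n, ∀ i < k n, c a i = c (x n) i := by
    intro n i hi
    rw [ha]
    change c (x (i + 1)) i = c (x n) i
    rcases le_total (i + 1) n with hin | hin
    · exact (hagree _ _ hin i (hkle (i + 1))).symm
    · exact hagree _ _ hin i hi
  have hφ : Tendsto (fun n => φ (x (n + 1))) atTop (𝓝 (φ a)) := by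
    rw [tendsto_order]
    refine ⟨fun r hr => ?_, fun r hr => ?_⟩
    · obtain ⟨j, hj⟩ := h.exists_cylinder_lt hr
      filter_upwards [eventually_ge_atTop j] with n hn
      refine hj _ fun i hi => (hca (n + 1) i ?_).symm
      have := hkle (n + 1)
      omega
    · filter_upwards [(tendsto_one_div_add_atTop_nhds_zero_nat (𝕜 := ℝ)).eventually_lt_const
        (sub_pos.2 hr)] with n hn
      have := hlow n a (hca (n + 1))
      linarith
  have hφ' : Tendsto (fun n => φ (x' n)) atTop (𝓝 (φ a)) := by
    have h0 : Tendsto (fun n => φ (x' n) - φ (x (n + 1))) atTop (𝓝 0) :=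
      squeeze_zero_norm hgap tendsto_one_div_add_atTop_nhds_zero_nat
    simpa using h0.add hφ
  have hlim : Tendsto (fun n => x (n + 1)) atTop (𝓝 a) := by
    refine h.tendsto hφ fun i => ?_
    filter_upwards [eventually_ge_atTop i] with n hn
    refine (hca (n + 1) i ?_).symm
    have := hkle (n + 1)
    omega
  have hlim' : Tendsto x' atTop (𝓝 a) := by
    refine h.tendsto hφ' fun i => ?_
    filter_upwards [eventually_ge_atTop (i + 1)] with n hn
    have hi : i < k n := by
      have := hkle n
      omega
    exact (hx'1 n i hi).trans (hca n i hi).symm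
  exact hU.compl.1.mem_of_tendsto hlim' (.of_forall hx'U)
    (hU.1.mem_of_tendsto hlim (.of_forall fun n => (hxU (n + 1)).1))

open Classical in
/-- If the cylinder of length `k` around `a` meets `S` only where `φ > r`, this is the least `m`
such that `φ > r` on the cylinder of length `m` around `a`; otherwise it is `0`. -/
def escapeLength (φ : A → ℝ) (c : A → ℕ → ℕ) (S : Set A) (k : ℕ) (r : ℝ) (a : A) : ℕ :=
  if ∀ x ∈ S, (∀ i < k, c x i = c a i) → r < φ x then
    sInf {m | ∀ x, (∀ i < m, c x i = c a i) → r < φ x}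
  else 0

lemma LSCGraph.escapeLength_spec (h : LSCGraph φ c) {S : Set A} {k : ℕ} {r : ℝ} {a : A}
    (ha : a ∈ S) (hk : ∀ x ∈ S, (∀ i < k, c x i = c a i) → r < φ x) :
    ∀ x, (∀ i < escapeLength φ c S k r a, c x i = c a i) → r < φ x := by
  rw [escapeLength, if_pos hk]
  exact Nat.sInf_mem (s := {m | ∀ x, (∀ i < m, c x i = c a i) → r < φ x})
    (h.exists_cylinder_lt (hk a ha fun _ _ => rfl))

lemma LSCGraph.escapeLength_congr (h : LSCGraph φ c) {S : Set A} {k : ℕ} {r : ℝ} {a : A}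
    (ha : a ∈ S) : ∃ K, ∀ b, (∀ i < K, c b i = c a i) →
      escapeLength φ c S k r b = escapeLength φ c S k r a := by
  by_cases hk : ∀ x ∈ S, (∀ i < k, c x i = c a i) → r < φ x
  · refine ⟨max k (escapeLength φ c S k r a), fun b hb => ?_⟩
    have hbk : ∀ x ∈ S, (∀ i < k, c x i = c b i) → r < φ x := fun x hx hxb =>
      hk x hx fun i hi => (hxb i hi).trans (hb i (hi.trans_le (le_max_left _ _)))
    have spec := h.escapeLength_spec ha hk
    rw [escapeLength, if_pos hbk]
    have hmem : escapeLength φ c S k r a ∈ {m | ∀ x, (∀ i < m, c x i = c b i) → r < φ x} :=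
      fun x hx => spec x fun i hi => (hx i hi).trans (hb i (hi.trans_le (le_max_right _ _)))
    have hle := Nat.sInf_le hmem
    refine le_antisymm hle ?_
    have hmem' := Nat.sInf_mem ⟨_, hmem⟩
    nth_rewrite 1 [escapeLength]
    rw [if_pos hk]
    refine Nat.sInf_le fun x hx => hmem' x fun i hi => (hx i hi).trans (hb i ?_).symm
    exact hi.trans_le (hle.trans (le_max_right _ _))
  · refine ⟨k, fun b hb => ?_⟩
    rw [escapeLength, escapeLength, if_neg hk, if_neg]
    exact fun hbk => hk fun x hx hxa => hbk x hx fun i hi => (hxa i hi).trans (hb i hi).symm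

/-- The code of a closed subset, refined by the escape lengths. -/
def closedCode (φ : A → ℝ) (c : A → ℕ → ℕ) (S : Set A) (a : S) (n : ℕ) : ℕ :=
  Nat.pair (c a n) (escapeLength φ c S ((Denumerable.eqv (ℕ × ℚ)).symm n).1
    ((Denumerable.eqv (ℕ × ℚ)).symm n).2 a)

lemma LSCGraph.closedCode_congr (h : LSCGraph φ c) (S : Set A) (a : S) (k : ℕ) :
    ∃ K, ∀ b : S, (∀ i < K, c b i = c a i) →
      ∀ i < k, closedCode φ c S b i = closedCode φ c S a i := by
  induction k with
  | zero => exact ⟨0, fun _ _ i hi => absurd hi (Nat.not_lt_zero i)⟩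
  | succ k ih =>
    obtain ⟨K, hK⟩ := ih
    obtain ⟨K', hK'⟩ := h.escapeLength_congr (k := ((Denumerable.eqv (ℕ × ℚ)).symm k).1)
      (r := ((Denumerable.eqv (ℕ × ℚ)).symm k).2) a.2
    refine ⟨max (max K K') (k + 1), fun b hb i hi => ?_⟩
    rcases Nat.lt_succ_iff_lt_or_eq.1 hi with hi | rfl
    · exact hK b (fun i hi => hb i (by omega)) i hi
    · rw [closedCode, closedCode, hb i (by omega), hK' b fun j hj => hb j (by omega)]

/-- Closed subsets inherit the structure, for a refined code. -/
lemma LSCGraph.closed_subset (h : LSCGraph φ c) {S : Set A} (hS : IsClosed S) :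
    LSCGraph (fun a : S => φ a) (closedCode φ c S) := by
  have hfst : ∀ (a : S) i, (closedCode φ c S a i).unpair.1 = c a i := fun a i => by
    simp [closedCode]
  have hsnd : ∀ (a : S) (k : ℕ) (r : ℚ), escapeLength φ c S k r a =
      (closedCode φ c S a (Denumerable.eqv (ℕ × ℚ) (k, r))).unpair.2 := fun a k r => by
    simp [closedCode]
  refine ⟨fun a => h.nonneg a, ?_, fun a b hab => ?_, fun s r hs => ?_⟩
  · refine IsInducing.of_comp (g := fun z : ℝ × (ℕ → ℕ) => (z.1, fun i => (z.2 i).unpair.1))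
      ?_ ?_ ?_
    · refine (h.continuous_fun.comp continuous_subtype_val).prodMk (continuous_pi fun i => ?_)
      refine IsLocallyConstant.continuous ((IsLocallyConstant.iff_eventually_eq _).2 fun a => ?_)
      obtain ⟨K, hK⟩ := h.closedCode_congr S a (i + 1)
      have := (h.isClopen_cylinder (c a) K).isOpen.preimage (continuous_subtype_val (p := (· ∈ S)))
      filter_upwards [this.mem_nhds (show a ∈ _ from fun _ _ => rfl)] with b hb
      exact hK b hb i (Nat.lt_succ_self i)
    · refine continuous_fst.prodMk (continuous_pi fun i => ?_)
      exact (continuous_of_discreteTopology (f := fun l : ℕ => l.unpair.1)).comp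
        ((continuous_apply i).comp continuous_snd)
    · have := h.inducing.comp (IsInducing.subtypeVal (t := S))
      convert this using 1
      ext a
      · rfl
      · exact hfst a _
  · refine Subtype.ext (h.injective (funext fun i => ?_))
    rw [← hfst, ← hfst, hab]
  · choose x hxs hxr using hs
    have hxc : ∀ k, ∀ i < k, c (x k) i = (s i).unpair.1 := fun k i hi => by
      rw [← hfst, hxs k i hi]
    obtain ⟨a, ha, har⟩ := h.complete (fun i => (s i).unpair.1) r fun k =>
      ⟨x k, hxc k, hxr k⟩
    have hxa : ∀ k, ∀ i < k, c (x k) i = c a i := fun k i hi => by rw [hxc k i hi, ha]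
    have haS : a ∈ S := by
      by_contra haS
      obtain ⟨k, r', hr', hk⟩ : ∃ (k : ℕ) (r' : ℚ), φ a < r' ∧
          ∀ y ∈ S, (∀ i < k, c y i = c a i) → (r' : ℝ) < φ y := by
        by_contra! H
        refine haS ?_
        choose q hq hq' using fun n : ℕ => exists_rat_btwn
          (show φ a < φ a + 1 / ((n : ℝ) + 1) from lt_add_of_pos_right _ (by positivity))
        choose y hyS hya hyq using fun n => H n (q n) (hq n)
        refine hS.mem_of_tendsto (h.tendsto (x := y) ?_ fun i => ?_) (.of_forall hyS)
        · rw [tendsto_order]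
          refine ⟨fun t ht => ?_, fun t ht => ?_⟩
          · obtain ⟨j, hj⟩ := h.exists_cylinder_lt ht
            filter_upwards [eventually_ge_atTop j] with n hn
            exact hj _ fun i hi => hya n i (hi.trans_le hn)
          · filter_upwards [(tendsto_one_div_add_atTop_nhds_zero_nat
              (𝕜 := ℝ)).eventually_lt_const (sub_pos.2 ht)] with n hn
            have h1 := hyq n
            have h2 := hq' n
            linarith
        · filter_upwards [eventually_gt_atTop i] with n hn
          exact hya n i hn
      have hev : ∀ m, k ≤ m → ∀ y ∈ S, (∀ i < k, c y i = c (x m) i) → (r' : ℝ) < φ y :=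
        fun m hm y hy hyx => hk y hy fun i hi => (hyx i hi).trans (hxa m i (hi.trans_le hm))
      let e := Denumerable.eqv (ℕ × ℚ) (k, r')
      let M := (s e).unpair.2
      let m := max (max k M) (e + 1)
      have hM : escapeLength φ c S k r' (x m) = M := by
        rw [hsnd, hxs m e (by omega)]
      have := h.escapeLength_spec (x m).2 (hev m (by omega)) a fun i hi =>
        (hxa m i (by rw [hM] at hi; omega)).symm
      linarith
    refine ⟨⟨a, haS⟩, funext fun i => ?_, har⟩
    obtain ⟨K, hK⟩ := h.closedCode_congr S ⟨a, haS⟩ (i + 1)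
    rw [← hK (x (max K (i + 1))) (fun j hj => hxa _ j (by omega)) i (Nat.lt_succ_self i)]
    exact hxs _ i (by omega)

end Constructions

section ErdosSpace

lemma hasSum_sq_coord (x : lp (fun _ : ℕ => ℝ) 2) : HasSum (fun n => x n ^ 2) (‖x‖ ^ 2) := by
  have h := lp.hasSum_inner (𝕜 := ℝ) x x
  rw [real_inner_self_eq_norm_sq] at h
  simpa [pow_two] using h

/-- The possible coordinates of points of `Ec`. -/
def IsErdosCoord (z : ℝ) : Prop := z = 0 ∨ ∃ m : ℕ, z = 1 / (m + 1)

lemma IsErdosCoord.nonneg {z : ℝ} (h : IsErdosCoord z) : 0 ≤ z := by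
  obtain rfl | ⟨m, rfl⟩ := h
  · exact le_rfl
  · positivity

lemma isClosed_isErdosCoord : IsClosed {z | IsErdosCoord z} := by
  have h := (tendsto_one_div_add_atTop_nhds_zero_nat (𝕜 := ℝ)).isCompact_insert_range.isClosed
  convert h using 1
  ext z
  simp [IsErdosCoord, eq_comm]

lemma IsErdosCoord.le_iff_lt {z : ℝ} (h : IsErdosCoord z) (m : ℕ) :
    1 / ((m : ℝ) + 1) ≤ z ↔ 1 / ((m : ℝ) + 2) < z := by
  obtain rfl | ⟨k, rfl⟩ := h
  · exact iff_of_false (not_le.2 (by positivity)) (not_lt.2 (by positivity))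
  · rw [one_div_le_one_div (by positivity) (by positivity),
      one_div_lt_one_div (by positivity) (by positivity)]
    norm_cast
    omega

lemma IsErdosCoord.eventually_le_iff {ι : Type*} {l : Filter ι} {y : ι → ℝ} {z : ℝ}
    (hy : ∀ i, IsErdosCoord (y i)) (hz : IsErdosCoord z) (h : Tendsto y l (𝓝 z)) (m : ℕ) :
    ∀ᶠ i in l, (1 / ((m : ℝ) + 1) ≤ y i ↔ 1 / ((m : ℝ) + 1) ≤ z) := by
  by_cases hm : 1 / ((m : ℝ) + 1) ≤ z
  · filter_upwards [h.eventually_const_lt ((hz.le_iff_lt m).1 hm)] with i hi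
    exact iff_of_true (((hy i).le_iff_lt m).2 hi) hm
  · filter_upwards [h.eventually_lt_const (not_le.1 hm)] with i hi
    exact iff_of_false (not_le.2 hi) hm

open Classical in
/-- The bits recording which numbers `1 / (m + 1)` are at most which coordinates. -/
def erdosCode (x : Ec) (i : ℕ) : ℕ :=
  if 1 / ((i.unpair.2 : ℝ) + 1) ≤ x.1 i.unpair.1 then 1 else 0

lemma erdosCode_eq_iff {x y : Ec} {i : ℕ} : erdosCode x i = erdosCode y i ↔
    (1 / ((i.unpair.2 : ℝ) + 1) ≤ x.1 i.unpair.1 ↔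
      1 / ((i.unpair.2 : ℝ) + 1) ≤ y.1 i.unpair.1) := by
  unfold erdosCode
  split_ifs with h h' h' <;> simp only [h, h'] <;> simp

lemma Ec.isErdosCoord (x : Ec) (n : ℕ) : IsErdosCoord (x.1 n) := x.2 n

lemma sub_le_of_erdosCode_eq {x y : Ec} {n M : ℕ}
    (h : ∀ m ≤ M, erdosCode x (Nat.pair n m) = erdosCode y (Nat.pair n m)) :
    x.1 n - y.1 n ≤ 1 / ((M : ℝ) + 1) := by
  have hy := (y.isErdosCoord n).nonneg
  obtain hx | ⟨m, hx⟩ := x.isErdosCoord n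
  · have : 0 ≤ 1 / ((M : ℝ) + 1) := by positivity
    linarith
  · rcases le_total m M with hm | hm
    · have := erdosCode_eq_iff.1 (h m hm)
      simp only [Nat.unpair_pair] at this
      have := this.1 hx.ge
      have : 0 ≤ 1 / ((M : ℝ) + 1) := by positivity
      linarith
    · have : 1 / ((m : ℝ) + 1) ≤ 1 / ((M : ℝ) + 1) := by gcongr
      linarith

lemma abs_sub_le_of_erdosCode_eq {x y : Ec} {n M : ℕ}
    (h : ∀ m ≤ M, erdosCode x (Nat.pair n m) = erdosCode y (Nat.pair n m)) :
    |x.1 n - y.1 n| ≤ 1 / ((M : ℝ) + 1) :=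
  abs_sub_le_iff.2 ⟨sub_le_of_erdosCode_eq h, sub_le_of_erdosCode_eq fun m hm => (h m hm).symm⟩

lemma erdosCode_injective : Function.Injective erdosCode := by
  refine fun x y h => Subtype.ext (lp.ext (funext fun n => ?_))
  have h0 : |x.1 n - y.1 n| ≤ 0 := ge_of_tendsto' tendsto_one_div_add_atTop_nhds_zero_nat
    fun M => abs_sub_le_of_erdosCode_eq fun m _ => congrFun h _
  exact sub_eq_zero.1 (abs_nonpos_iff.1 h0)

lemma continuous_coord (n : ℕ) : Continuous fun x : Ec => x.1 n :=
  ((lp.uniformContinuous_coe (p := 2) (E := fun _ : ℕ => ℝ)).continuous.comp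
    continuous_subtype_val |> continuous_pi_iff.1) n

lemma tendsto_coord_of_erdosCode {ι : Type*} {l : Filter ι} {y : ι → Ec} {x : Ec}
    (h : ∀ i, ∀ᶠ j in l, erdosCode (y j) i = erdosCode x i) (n : ℕ) :
    Tendsto (fun j => (y j).1 n) l (𝓝 (x.1 n)) := by
  rw [Metric.tendsto_nhds]
  intro ε hε
  obtain ⟨M, hM⟩ := exists_nat_one_div_lt hε
  have : ∀ᶠ j in l, ∀ m ∈ Set.Iic M, erdosCode (y j) (Nat.pair n m) =
      erdosCode x (Nat.pair n m) := (eventually_all_finite (Set.finite_Iic M)).2 fun m _ => h _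
  filter_upwards [this] with j hj
  exact (abs_sub_le_of_erdosCode_eq hj).trans_lt hM

lemma tendsto_of_tendsto_norm_of_coord {ι : Type*} {l : Filter ι} {y : ι → Ec} {x : Ec}
    (hn : Tendsto (fun j => ‖(y j).1‖ ^ 2) l (𝓝 (‖x.1‖ ^ 2)))
    (hc : ∀ n, Tendsto (fun j => (y j).1 n) l (𝓝 (x.1 n))) : Tendsto y l (𝓝 x) := by
  rw [tendsto_subtype_rng, tendsto_iff_norm_sub_tendsto_zero]
  have hsq : Tendsto (fun j => ‖(y j).1 - x.1‖ ^ 2) l (𝓝 0) := by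
    rw [tendsto_order]
    refine ⟨fun r hr => .of_forall fun j => hr.trans_le (by positivity), fun r hr => ?_⟩
    obtain ⟨s, hs⟩ := ((hasSum_sq_coord x.1).eventually_const_lt
      (show ‖x.1‖ ^ 2 - r / 2 < ‖x.1‖ ^ 2 by linarith)).exists
    have h1 : Tendsto (fun j => ‖(y j).1‖ ^ 2 + ‖x.1‖ ^ 2 - 2 * ∑ n ∈ s, x.1 n * (y j).1 n) l
        (𝓝 (‖x.1‖ ^ 2 + ‖x.1‖ ^ 2 - 2 * ∑ n ∈ s, x.1 n * x.1 n)) :=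
      (hn.add_const _).sub ((tendsto_finsetSum s fun n _ => (hc n).const_mul _).const_mul 2)
    simp only [← pow_two] at h1
    filter_upwards [h1.eventually_lt_const (show _ < r by linarith)] with j hj
    refine lt_of_le_of_lt ?_ hj
    have hin := lp.hasSum_inner (𝕜 := ℝ) (y j).1 x.1
    have hle := sum_le_hasSum s (fun n _ => ?_) hin
    · have he : ∀ a b : ℝ, inner ℝ a b = b * a := fun a b => by simp
      simp only [he] at hle
      rw [norm_sub_sq_real]
      linarith
    · simpa using mul_nonneg (x.isErdosCoord n).nonneg ((y j).isErdosCoord n).nonneg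
  have := hsq.sqrt
  simpa using this

lemma erdosCode_eventually_eq {ι : Type*} {l : Filter ι} {y : ι → Ec} {x : Ec}
    (hc : ∀ n, Tendsto (fun j => (y j).1 n) l (𝓝 (x.1 n))) (i : ℕ) :
    ∀ᶠ j in l, erdosCode (y j) i = erdosCode x i := by
  simp only [erdosCode_eq_iff]
  exact IsErdosCoord.eventually_le_iff (fun j => (y j).isErdosCoord _) (x.isErdosCoord _) (hc _) _

lemma erdos_lscGraph : LSCGraph (fun x : Ec => ‖x.1‖ ^ 2) erdosCode := by
  refine ⟨fun x => by positivity, ?_, erdosCode_injective, fun s r hs => ?_⟩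
  · rw [isInducing_iff_nhds]
    refine fun x => le_antisymm ?_ ?_
    · rw [← tendsto_iff_comap]
      refine Tendsto.prodMk_nhds ?_ (tendsto_pi_nhds.2 fun i => ?_)
      · exact (continuous_subtype_val.norm.pow 2).tendsto x
      · exact (tendsto_congr' (erdosCode_eventually_eq
          (fun n => (continuous_coord n).tendsto x) i)).2 tendsto_const_nhds
    · set f := fun x : Ec => (‖x.1‖ ^ 2, erdosCode x)
      have h0 : Tendsto f (comap f (𝓝 (f x))) (𝓝 (f x)) := tendsto_comap
      refine tendsto_of_tendsto_norm_of_coord (y := id) ((continuous_fst.tendsto _).comp h0)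
        (tendsto_coord_of_erdosCode fun i => ?_)
      have h1 : Tendsto (fun y => erdosCode y i) (comap f (𝓝 (f x))) (𝓝 (erdosCode x i)) :=
        (((continuous_apply i).comp continuous_snd).tendsto (f x)).comp h0
      rwa [nhds_discrete ℕ, tendsto_pure] at h1
  · choose x hxs hxr using hs
    have hcauchy : ∀ n, CauchySeq fun k => (x k).1 n := by
      intro n
      rw [Metric.cauchySeq_iff']
      intro ε hε
      obtain ⟨M, hM⟩ := exists_nat_one_div_lt hε
      refine ⟨Nat.pair n M + 1, fun k hk => lt_of_le_of_lt ?_ hM⟩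
      refine abs_sub_le_of_erdosCode_eq fun m hm => ?_
      have : Nat.pair n m ≤ Nat.pair n M :=
        hm.lt_or_eq.elim (fun h => (Nat.pair_lt_pair_right n h).le) fun h => h ▸ le_rfl
      rw [hxs _ _ (by omega), hxs _ _ (by omega)]
    choose a ha using fun n => cauchySeq_tendsto_of_complete (hcauchy n)
    have hr : 0 ≤ r := le_trans (by positivity) (hxr 0)
    have hbdd : ∀ k, ‖(x k).1‖ ≤ Real.sqrt r := fun k => Real.le_sqrt_of_sq_le (hxr k)
    have hlim : Tendsto (fun k => ((x k).1 : ℕ → ℝ)) atTop (𝓝 a) := tendsto_pi_nhds.2 ha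
    have hmem : Memℓp a 2 := lp.memℓp_of_tendsto
      (isBounded_iff_forall_norm_le.2 ⟨_, by rintro _ ⟨k, rfl⟩; exact hbdd k⟩) hlim
    let A : lp (fun _ : ℕ => ℝ) 2 := ⟨a, hmem⟩
    let b : Ec := ⟨A, fun n => isClosed_isErdosCoord.mem_of_tendsto (ha n)
      (.of_forall fun k => (x k).isErdosCoord n)⟩
    have hA : ‖A‖ ≤ Real.sqrt r := lp.norm_le_of_tendsto (.of_forall hbdd) hlim
    refine ⟨b, funext fun i => ?_, ?_⟩
    · obtain ⟨k, hk, hki⟩ := ((erdosCode_eventually_eq (x := b) ha i).and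
        (eventually_gt_atTop i)).exists
      rw [← hk, hxs k i hki]
    · calc ‖A‖ ^ 2 ≤ Real.sqrt r ^ 2 := by gcongr
        _ = r := Real.sq_sqrt hr

instance : Nonempty Ec := ⟨⟨0, fun _ => .inl rfl⟩⟩

lemma erdos_clopenUnbounded : ClopenUnbounded fun x : Ec => ‖x.1‖ ^ 2 := by
  refine erdos_lscGraph.clopenUnbounded_of_chains dense_univ fun x _ k ε hε => ?_
  obtain ⟨N, hN⟩ := exists_nat_one_div_lt (lt_min hε one_pos)
  set δ : ℝ := 1 / ((N : ℝ) + 1) with hδ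
  have hδ0 : 0 < δ := by positivity
  have hδ1 : δ ^ 2 ≤ ε := by
    have h1 := hN.trans_le (min_le_left _ _)
    have h2 := hN.trans_le (min_le_right _ _)
    nlinarith
  have h0 := (hasSum_sq_coord x.1).summable.tendsto_atTop_zero
  obtain ⟨J₀, hJ₀⟩ := eventually_atTop.1 (h0.eventually_lt_const (pow_pos hδ0 2))
  set J := max J₀ k
  let f : ℕ → ℕ → ℝ := fun l j => if J ≤ j ∧ j < J + l then δ else x.1 j
  have hmem : ∀ l, Memℓp (f l) 2 := by
    intro l
    refine memℓp_gen ?_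
    refine ((lp.memℓp x.1).summable (by norm_num)).congr_cofinite ?_
    have : {j | ¬ J + l ≤ j}.Finite := (Set.finite_lt_nat (J + l)).subset fun j hj => not_le.1 hj
    filter_upwards [this.compl_mem_cofinite] with j hj
    have hj' : J + l ≤ j := not_not.1 hj
    simp only [f]
    rw [if_neg (by omega)]
  let y : ℕ → Ec := fun l => ⟨⟨f l, hmem l⟩, fun j => by
    change IsErdosCoord (f l j)
    simp only [f]
    split_ifs
    · exact .inr ⟨N, rfl⟩
    · exact x.isErdosCoord j⟩
  have hy : ∀ l j, (y l).1 j = f l j := fun _ _ => rfl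
  refine ⟨y, ?_, fun l => ⟨Set.mem_univ _, fun i hi => ?_, ?_⟩, fun R => ?_⟩
  · refine Subtype.ext (lp.ext (funext fun j => ?_))
    rw [hy]
    exact if_neg (by omega)
  · rw [erdosCode_eq_iff, hy]
    have := Nat.unpair_left_le i
    simp only [f]
    rw [if_neg (by omega)]
  · have hs := (hasSum_sq_coord (y (l + 1)).1).sub (hasSum_sq_coord (y l).1)
    have hs' := hs.unique (hasSum_single (J + l) fun j hj => ?_)
    · have e1 : f (l + 1) (J + l) = δ := if_pos (by omega)
      have e2 : f l (J + l) = x.1 (J + l) := if_neg (by omega)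
      have h3 := hJ₀ (J + l) (by omega)
      simp only [hy, e1, e2] at hs'
      rw [hs', abs_le]
      constructor <;> nlinarith [sq_nonneg (x.1 (J + l))]
    · rw [hy, hy]
      simp only [f]
      by_cases hj' : J ≤ j ∧ j < J + l
      · rw [if_pos hj', if_pos (by omega), sub_self]
      · rw [if_neg hj', if_neg (by omega), sub_self]
  · obtain ⟨l, hl⟩ := exists_nat_ge (R / δ ^ 2)
    refine ⟨l, ?_⟩
    rw [div_le_iff₀ (by positivity)] at hl
    refine hl.trans ?_
    have hle := sum_le_hasSum (Finset.Ico J (J + l)) (fun j _ => sq_nonneg _)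
      (hasSum_sq_coord (y l).1)
    refine le_trans (le_of_eq ?_) hle
    rw [Finset.sum_congr rfl (g := fun _ => δ ^ 2)]
    · simp
    · intro j hj
      rw [hy]
      simp only [f]
      rw [if_pos (Finset.mem_Ico.1 hj)]

end ErdosSpace

section Endpoints

/-- The first coordinate of the orbit of `(t, s)` under `calF`. -/
def orbit (s : ℕ → ℤ) (t : ℝ) : ℕ → ℝ
  | 0 => t
  | n + 1 => F (orbit s t n) - (|s n| : ℝ)

lemma shift_iterate (s : ℕ → ℤ) (m i : ℕ) : shift^[m] s i = s (m + i) := by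
  induction m generalizing s with
  | zero => simp
  | succ m ih =>
    rw [Function.iterate_succ_apply, ih]
    exact congrArg s (by omega)

lemma calF_iterate (s : ℕ → ℤ) (t : ℝ) (n : ℕ) :
    calF^[n] (t, s) = (orbit s t n, shift^[n] s) := by
  induction n with
  | zero => rfl
  | succ n ih =>
    rw [Function.iterate_succ_apply', ih, Function.iterate_succ_apply']
    simp [calF, orbit, shift_iterate]

lemma mem_J_iff {s : ℕ → ℤ} {t : ℝ} : (t, s) ∈ J ↔ ∀ n, 0 ≤ orbit s t n := by
  simp [J, calF_iterate]

lemma F_strictMono : StrictMono F := fun a b h =>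
  sub_lt_sub_right (Real.rpow_lt_rpow_of_exponent_lt (by norm_num) h) 1

lemma continuous_F : Continuous F :=
  (Real.continuous_const_rpow (by norm_num)).sub continuous_const

lemma F_add_le {a δ : ℝ} (ha : 0 ≤ a) (hδ : 0 ≤ δ) : F a + Real.log 3 * δ ≤ F (a + δ) := by
  have h1 : (1 : ℝ) ≤ 3 ^ a := Real.one_le_rpow (by norm_num) ha
  have h2 : Real.log 3 * δ + 1 ≤ (3 : ℝ) ^ δ := by
    rw [Real.rpow_def_of_pos (by norm_num)]
    exact Real.add_one_le_exp _
  have h3 : 0 ≤ Real.log 3 * δ := mul_nonneg (Real.log_nonneg (by norm_num)) hδ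
  unfold F
  rw [Real.rpow_add (by norm_num)]
  nlinarith

lemma orbit_mono {s s' : ℕ → ℤ} {t t' : ℝ} (h : t ≤ t') {n : ℕ}
    (hs : ∀ i < n, |s' i| ≤ |s i|) : orbit s t n ≤ orbit s' t' n := by
  induction n with
  | zero => exact h
  | succ n ih =>
    refine sub_le_sub (F_strictMono.monotone (ih fun i hi => hs i (by omega))) ?_
    exact_mod_cast hs n (by omega)

lemma continuous_orbit (s : ℕ → ℤ) (n : ℕ) : Continuous fun t => orbit s t n := by
  induction n with
  | zero => exact continuous_id
  | succ n ih => exact (continuous_F.comp ih).sub continuous_const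

lemma tmin_mem_J {s : ℕ → ℤ} (hs : s ∈ Sset) : (tmin s, s) ∈ J := by
  obtain ⟨t, -, ht⟩ := hs
  refine IsClosed.csInf_mem (s := {t | (t, s) ∈ J}) ?_ ⟨t, ht⟩ ⟨0, fun t ht => mem_J_iff.1 ht 0⟩
  simp only [mem_J_iff, Set.ofPred_forall]
  exact isClosed_iInter fun n => isClosed_le continuous_const (continuous_orbit s n)

lemma tmin_le {s : ℕ → ℤ} {t : ℝ} (h : (t, s) ∈ J) : tmin s ≤ t :=
  csInf_le ⟨0, fun _ ht => mem_J_iff.1 ht 0⟩ h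

lemma mem_Sset_of_mem_J {s : ℕ → ℤ} {t : ℝ} (h : (t, s) ∈ J) : s ∈ Sset :=
  ⟨t, mem_J_iff.1 h 0, h⟩

lemma tmin_mono {s s' : ℕ → ℤ} (h : ∀ i, |s i| ≤ |s' i|) (hs' : s' ∈ Sset) :
    tmin s ≤ tmin s' :=
  tmin_le (mem_J_iff.2 fun n => (mem_J_iff.1 (tmin_mem_J hs') n).trans
    (orbit_mono le_rfl fun i _ => h i))

/-- The code of an endpoint. -/
def endpointCode (x : Efan) (i : ℕ) : ℕ := Equiv.intEquivNat (x.1.2 i)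

lemma endpoint_lscGraph : LSCGraph (fun x : Efan => x.1.1) endpointCode := by
  refine ⟨fun x => ?_, ?_, fun x y h => ?_, fun s r hs => ?_⟩
  · have := mem_J_iff.1 (tmin_mem_J x.2.1) 0
    rwa [← x.2.2] at this
  · let e : ℤ ≃ₜ ℕ := ⟨Equiv.intEquivNat, continuous_of_discreteTopology,
      continuous_of_discreteTopology⟩
    exact ((Homeomorph.refl ℝ).prodCongr (Homeomorph.piCongrRight fun _ : ℕ => e)).isInducing.comp
      IsInducing.subtypeVal
  · have h2 : x.1.2 = y.1.2 := funext fun i => Equiv.intEquivNat.injective (congrFun h i)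
    refine Subtype.ext (Prod.ext ?_ h2)
    rw [x.2.2, y.2.2, h2]
  · choose x hx hxr using hs
    let σ : ℕ → ℤ := fun i => Equiv.intEquivNat.symm (s i)
    have hσ : ∀ k, ∀ i < k, (x k).1.2 i = σ i := fun k i hi =>
      (Equiv.eq_symm_apply _).2 (hx k i hi)
    have hJ : (r, σ) ∈ J := mem_J_iff.2 fun n => by
      have h1 := mem_J_iff.1 (tmin_mem_J (x n).2.1) n
      refine h1.trans (orbit_mono ((x n).2.2 ▸ hxr n) fun i hi => ?_)
      rw [hσ n i hi]
    refine ⟨⟨(tmin σ, σ), mem_Sset_of_mem_J hJ, rfl⟩, funext fun i => ?_, tmin_le hJ⟩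
    exact Equiv.apply_symm_apply _ _

lemma abs_le_iterate {s : ℕ → ℤ} {t : ℝ} (h : (t, s) ∈ J) (n : ℕ) :
    (|s n| : ℝ) ≤ F^[n + 1] t := by
  have hle : ∀ n, orbit s t n ≤ F^[n] t := by
    intro n
    induction n with
    | zero => exact le_rfl
    | succ n ih =>
      rw [Function.iterate_succ_apply']
      exact (sub_le_self _ (abs_nonneg _)).trans (F_strictMono.monotone ih)
  rw [Function.iterate_succ_apply']
  exact (sub_nonneg.1 (mem_J_iff.1 h (n + 1))).trans (F_strictMono.monotone (hle n))

lemma Finv_F : Function.LeftInverse Finv F := fun t => by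
  simp [Finv, F]

lemma Finv_iterate_mono (n : ℕ) : ∀ {a b : ℝ}, 0 ≤ a → a ≤ b → Finv^[n] a ≤ Finv^[n] b := by
  induction n with
  | zero => exact fun _ h => h
  | succ n ih =>
    intro a b ha hab
    refine ih (Real.logb_nonneg (by norm_num) (by linarith)) ?_
    exact Real.logb_le_logb_of_le (by norm_num) (by linarith) (by linarith)

lemma bddAbove_tstar {s : ℕ → ℤ} (hs : s ∈ Sset) :
    BddAbove (Set.range fun k : ℕ => Finv^[k + 1] (|s (k + 1)| : ℝ)) := by
  obtain ⟨t, -, ht⟩ := hs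
  refine ⟨F t, ?_⟩
  rintro _ ⟨k, rfl⟩
  refine (Finv_iterate_mono (k + 1) (abs_nonneg _) (abs_le_iterate ht (k + 1))).trans_eq ?_
  rw [Function.iterate_succ_apply F]
  exact (Finv_F.iterate (k + 1)) (F t)

lemma tstar_mono {s s' : ℕ → ℤ} (h : ∀ i, |s i| ≤ |s' i|) (hs' : s' ∈ Sset) :
    tstar s ≤ tstar s' :=
  ciSup_mono (bddAbove_tstar hs') fun k => Finv_iterate_mono _ (abs_nonneg _)
    (by exact_mod_cast h (k + 1))

lemma shift_iterate_mem_Sset {s : ℕ → ℤ} (hs : s ∈ Sset) (m : ℕ) : shift^[m] s ∈ Sset := by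
  obtain ⟨t, -, ht⟩ := hs
  refine mem_Sset_of_mem_J (t := orbit s t m) fun n => ?_
  rw [← calF_iterate, ← Function.iterate_add_apply]
  exact ht _

/-- Enlarging one entry by `1` moves the endpoint by at most `ε`, if the entry is far enough. -/
lemma mem_J_of_enlarge {s s' : ℕ → ℤ} {t ε : ℝ} {j : ℕ} (h : (t, s) ∈ J) (hε : 0 ≤ ε)
    (hj : 1 ≤ Real.log 3 ^ (j + 1) * ε) (hs : ∀ i ≠ j, s' i = s i) (hs' : |s' j| ≤ |s j| + 1) :
    (t + ε, s') ∈ J := by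
  have hJ := mem_J_iff.1 h
  have hlog : 0 ≤ Real.log 3 := Real.log_nonneg (by norm_num)
  have h1 : ∀ i, i ≤ j → orbit s t i + Real.log 3 ^ i * ε ≤ orbit s' (t + ε) i := by
    intro i
    induction i with
    | zero => intro _; simp [orbit]
    | succ i ih =>
      intro hi
      have h2 := F_add_le (hJ i) (δ := Real.log 3 ^ i * ε) (by positivity)
      have h3 := F_strictMono.monotone (ih (by omega))
      rw [orbit, orbit, hs i (by omega), pow_succ']
      linarith
  have h4 : ∀ n, j + 1 ≤ n → orbit s t n ≤ orbit s' (t + ε) n := by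
    intro n hn
    induction n, hn using Nat.le_induction with
    | base =>
      have h2 := F_add_le (hJ j) (δ := Real.log 3 ^ j * ε) (by positivity)
      have h3 := F_strictMono.monotone (h1 j le_rfl)
      have h5 : |(s' j : ℝ)| ≤ |(s j : ℝ)| + 1 := by exact_mod_cast hs'
      rw [pow_succ'] at hj
      rw [orbit, orbit]
      linarith
    | succ n hn ih =>
      rw [orbit, orbit, hs n (by omega)]
      exact sub_le_sub_right (F_strictMono.monotone ih) _
  refine mem_J_iff.2 fun n => (hJ n).trans ?_
  rcases le_or_gt n j with hn | hn
  · refine le_trans ?_ (h1 n hn)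
    have : 0 ≤ Real.log 3 ^ n * ε := by positivity
    linarith
  · exact h4 n hn

/-- Enlarge the absolute value of the entry with index `j` by `l`. -/
def enlarge (s : ℕ → ℤ) (j l : ℕ) : ℕ → ℤ :=
  Function.update s j (if 0 ≤ s j then s j + l else s j - l)

lemma enlarge_of_ne (s : ℕ → ℤ) {i j : ℕ} (l : ℕ) (h : i ≠ j) : enlarge s j l i = s i :=
  Function.update_of_ne h _ _

lemma abs_enlarge_self (s : ℕ → ℤ) (j l : ℕ) : |enlarge s j l j| = |s j| + l := by
  rw [enlarge, Function.update_self]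
  split_ifs with h
  · rw [abs_of_nonneg h, abs_of_nonneg (by omega)]
  · rw [abs_of_neg (by omega : s j < 0), abs_of_neg (by omega)]
    ring

lemma enlarge_zero (s : ℕ → ℤ) (j : ℕ) : enlarge s j 0 = s := by
  simp [enlarge]

lemma abs_enlarge_mono (s : ℕ → ℤ) (j : ℕ) {l l' : ℕ} (h : l ≤ l') (i : ℕ) :
    |enlarge s j l i| ≤ |enlarge s j l' i| := by
  by_cases hi : i = j
  · subst hi
    rw [abs_enlarge_self, abs_enlarge_self]
    omega
  · rw [enlarge_of_ne _ _ hi, enlarge_of_ne _ _ hi]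

lemma closure_Xfan_clopenUnbounded (n : ℕ) :
    ClopenUnbounded fun x : closure (Xfan n) => x.1.1.1 := by
  refine (endpoint_lscGraph.closed_subset isClosed_closure).clopenUnbounded_of_chains
    (D := {x | x.1 ∈ Xfan n}) ?_ fun x hx k ε hε => ?_
  · refine Subtype.dense_iff.2 fun x hx => closure_mono (fun y hy => ?_) hx
    exact ⟨⟨y, subset_closure hy⟩, hy, rfl⟩
  · obtain ⟨K, hK⟩ := endpoint_lscGraph.closedCode_congr (closure (Xfan n)) x k
    have hlog : 1 < Real.log 3 := by
      rw [Real.lt_log_iff_exp_lt (by norm_num)]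
      linarith [Real.exp_one_lt_d9]
    obtain ⟨j, hjK, hj⟩ : ∃ j, K ≤ j ∧ 1 ≤ Real.log 3 ^ (j + 1) * ε := by
      have := ((tendsto_pow_atTop_atTop_of_one_lt hlog).comp (tendsto_add_atTop_nat 1))
      obtain ⟨j, hj, hj'⟩ := ((eventually_ge_atTop K).and
        (this.eventually_ge_atTop (1 / ε))).exists
      exact ⟨j, hj, (div_le_iff₀ hε).1 hj'⟩
    let s := x.1.1.2
    have hstep : ∀ l, enlarge s j l ∈ Sset →
        (tmin (enlarge s j l) + ε, enlarge s j (l + 1)) ∈ J := fun l hl => by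
      refine mem_J_of_enlarge (tmin_mem_J hl) hε.le hj (fun i hi => ?_) ?_
      · rw [enlarge_of_ne _ _ hi, enlarge_of_ne _ _ hi]
      · rw [abs_enlarge_self, abs_enlarge_self]
        push_cast
        omega
    have hmem : ∀ l, enlarge s j l ∈ Sset := by
      intro l
      induction l with
      | zero => rw [enlarge_zero]; exact x.1.2.1
      | succ l ih => exact mem_Sset_of_mem_J (hstep l ih)
    let z : ℕ → Efan := fun l => ⟨(tmin (enlarge s j l), enlarge s j l), hmem l, rfl⟩
    have hz : ∀ l, z l ∈ Xfan n := fun l m hm => by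
      refine (hx m hm).trans_le (tstar_mono (fun i => ?_) (shift_iterate_mem_Sset (hmem l) _))
      rw [shift_iterate, shift_iterate]
      have := abs_enlarge_mono s j (Nat.zero_le l) (2 * m ^ 2 + i)
      rwa [enlarge_zero] at this
    refine ⟨fun l => ⟨z l, subset_closure (hz l)⟩, ?_, fun l => ⟨hz l, hK _ fun i hi => ?_, ?_⟩,
      fun R => ?_⟩
    · refine Subtype.ext (Subtype.ext (Prod.ext ?_ (enlarge_zero s j)))
      change tmin (enlarge s j 0) = _
      rw [enlarge_zero, x.1.2.2]
    · exact congrArg Equiv.intEquivNat (enlarge_of_ne s l (by omega))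
    · have h1 : tmin (enlarge s j (l + 1)) ≤ tmin (enlarge s j l) + ε := tmin_le (hstep l (hmem l))
      have h2 := tmin_mono (abs_enlarge_mono s j (Nat.le_succ l)) (hmem (l + 1))
      exact abs_le.2 ⟨by change _ ≤ tmin _ - tmin _; linarith,
        by change tmin _ - tmin _ ≤ _; linarith⟩
    · obtain ⟨l, hl⟩ := exists_nat_gt (F^[j + 1] R)
      refine ⟨l, ?_⟩
      by_contra! hR
      have h1 := abs_le_iterate (tmin_mem_J (hmem l)) j
      have h2 : F^[j + 1] (tmin (enlarge s j l)) ≤ F^[j + 1] R :=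
        F_strictMono.monotone.iterate (j + 1) hR.le
      have h3 : |(enlarge s j l j : ℝ)| = |(s j : ℝ)| + l := by
        exact_mod_cast abs_enlarge_self s j l
      have h4 := abs_nonneg (s j : ℝ)
      linarith

/-- The integers `F^j(1)`. -/
def tower : ℕ → ℕ
  | 0 => 1
  | j + 1 => 3 ^ tower j - 1

lemma two_mul_tower_lt (j : ℕ) : 1 + 2 * tower j ≤ 3 ^ tower j := by
  have := one_add_mul_le_pow (show (-2 : ℤ) ≤ 2 by norm_num) (tower j)
  norm_num at this
  zify
  linarith

lemma tower_pos (j : ℕ) : 0 < tower j := by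
  induction j with
  | zero => exact Nat.one_pos
  | succ j ih =>
    have := two_mul_tower_lt j
    rw [tower]
    omega

lemma tower_strictMono : StrictMono tower := strictMono_nat_of_lt_succ fun j => by
  have := two_mul_tower_lt j
  have := tower_pos j
  rw [tower]
  omega

lemma F_tower (j : ℕ) : F (tower j) = tower (j + 1) := by
  rw [tower, Nat.cast_sub (Nat.one_le_pow _ _ (by norm_num)), F, Real.rpow_natCast]
  simp

lemma iterate_F_one (j : ℕ) : F^[j] 1 = tower j := by
  induction j with
  | zero => simp [tower]
  | succ j ih => rw [Function.iterate_succ_apply', ih, F_tower]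

lemma tower_mem_Sset : (fun j => (tower j : ℤ)) ∈ Sset := by
  have h : ∀ j, (tower j : ℝ) + 1 ≤ orbit (fun j => (tower j : ℤ)) 2 j := by
    intro j
    induction j with
    | zero => norm_num [tower, orbit]
    | succ j ih =>
      have h1 := F_strictMono.monotone ih
      have h2 : F ((tower j : ℝ) + 1) = 3 * 3 ^ tower j - 1 := by
        rw [F, Real.rpow_add_one (by norm_num), Real.rpow_natCast]
        ring
      have h3 : (1 : ℝ) + 2 * tower j ≤ 3 ^ tower j := by exact_mod_cast two_mul_tower_lt j
      have h4 : (tower (j + 1) : ℝ) = 3 ^ tower j - 1 := by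
        rw [← F_tower, F, Real.rpow_natCast]
      have h5 : (0 : ℝ) ≤ tower j := by positivity
      rw [orbit, h4]
      simp only [Int.cast_natCast, abs_of_nonneg h5]
      linarith
  exact mem_Sset_of_mem_J (t := 2) (mem_J_iff.2 fun j => le_trans (by positivity) (h j))

lemma Xfan_nonempty (n : ℕ) : (Xfan n).Nonempty := by
  refine ⟨⟨(tmin _, fun j => (tower j : ℤ)), tower_mem_Sset, rfl⟩, fun k hk => ?_⟩
  have h1 := le_ciSup (bddAbove_tstar (shift_iterate_mem_Sset tower_mem_Sset (2 * k ^ 2))) 0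
  refine lt_of_lt_of_le ?_ h1
  have h2 : k - n < 2 * k ^ 2 := by
    have : 0 < k := by omega
    have : k < 2 * k ^ 2 := by nlinarith
    omega
  rw [iterate_F_one]
  simp only [shift_iterate, zero_add, Function.iterate_one, Int.cast_natCast, Nat.abs_cast]
  rw [← F_tower, Finv_F]
  exact_mod_cast tower_strictMono h2

end Endpoints

/-- For every n, the closure of Xₙ in E(𝓕) is homeomorphic to 𝔈_c. -/
theorem closure_Xfan_homeomorphic_Ec (n : ℕ) :
    Nonempty (↥(closure (Xfan n)) ≃ₜ Ec) := by
  have : Nonempty (closure (Xfan n)) := (Xfan_nonempty n).closure.to_subtype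
  exact (endpoint_lscGraph.closed_subset isClosed_closure).nonempty_homeomorph erdos_lscGraph
    (closure_Xfan_clopenUnbounded n) erdos_clopenUnbounded
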